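/- arXiv:0801.4162 — 2 statements merged into one kernel-verified Lean document; each statement's English description precedes it below -/
import Mathlib

section
/- Fix nonzero integers a_1, …, a_r with a_i ≠ ±a_j for i ≠ j, and fix nonzero integers n_1, …, n_r. Then there is a constant C (depending only on the a_j and n_j) such that for every sufficiently large prime p and every l ≥ 1, #Y_0(p^l) ≤ C·p^{l−1}. -/
open Finset

/-- The set `Y(p^l)` of tuples `x ∈ ((ℤ/p^lℤ)^*)^r` with
`a_1(x_1 + x_1⁻¹) = a_j(x_j + x_j⁻¹)` for all `j`. -/
def Yset (p l r : ℕ) (hr : 0 < r) (a : Fin r → ℤ) : Set (Fin r → (ZMod (p ^ l))ˣ) :=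
  {x | ∀ j : Fin r,
    (a ⟨0, hr⟩ : ZMod (p ^ l)) *
        ((x ⟨0, hr⟩ : ZMod (p ^ l)) + (((x ⟨0, hr⟩)⁻¹ : (ZMod (p ^ l))ˣ) : ZMod (p ^ l))) =
      (a j : ZMod (p ^ l)) *
        ((x j : ZMod (p ^ l)) + (((x j)⁻¹ : (ZMod (p ^ l))ˣ) : ZMod (p ^ l)))}

/-- The subset `Y₀(p^l) ⊆ Y(p^l)` of tuples with `x_1^{n_1}⋯x_r^{n_r} ≡ 1 (mod p^l)`. -/
def Yset₀ (p l r : ℕ) (hr : 0 < r) (a : Fin r → ℤ) (n : Fin r → ℤ) :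
    Set (Fin r → (ZMod (p ^ l))ˣ) :=
  {x | x ∈ Yset p l r hr a ∧ ∏ j : Fin r, (x j) ^ (n j) = 1}

/-- A subfield of `L` containing a square root `s` of an element of `F`, all of whose elements
have the form `α + β * s` with `α, β ∈ F`. -/
theorem Subfield.exists_adjoin_sqrt {L : Type*} [Field L] (F : Subfield L) {s : L}
    (hs : s ^ 2 ∈ F) :
    ∃ F' : Subfield L, F ≤ F' ∧ s ∈ F' ∧ ∀ x ∈ F', ∃ α ∈ F, ∃ β ∈ F, x = α + β * s := by
  refine ⟨{ carrier := {x | ∃ α ∈ F, ∃ β ∈ F, x = α + β * s}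
            mul_mem' := ?_, one_mem' := ⟨1, F.one_mem, 0, F.zero_mem, by simp⟩
            add_mem' := ?_, zero_mem' := ⟨0, F.zero_mem, 0, F.zero_mem, by simp⟩
            neg_mem' := ?_, inv_mem' := ?_ },
    fun x hx => ⟨x, hx, 0, F.zero_mem, by simp⟩, ⟨0, F.zero_mem, 1, F.one_mem, by simp⟩,
    fun x hx => hx⟩
  · rintro _ _ ⟨α, hα, β, hβ, rfl⟩ ⟨γ, hγ, δ, hδ, rfl⟩
    exact ⟨α * γ + β * δ * s ^ 2,
      F.add_mem (F.mul_mem hα hγ) (F.mul_mem (F.mul_mem hβ hδ) hs),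
      α * δ + β * γ, F.add_mem (F.mul_mem hα hδ) (F.mul_mem hβ hγ), by ring⟩
  · rintro _ _ ⟨α, hα, β, hβ, rfl⟩ ⟨γ, hγ, δ, hδ, rfl⟩
    exact ⟨α + γ, F.add_mem hα hγ, β + δ, F.add_mem hβ hδ, by ring⟩
  · rintro _ ⟨α, hα, β, hβ, rfl⟩
    exact ⟨-α, F.neg_mem hα, -β, F.neg_mem hβ, by ring⟩
  · rintro _ ⟨α, hα, β, hβ, rfl⟩
    by_cases hsF : s ∈ F
    · exact ⟨(α + β * s)⁻¹, F.inv_mem (F.add_mem hα (F.mul_mem hβ hsF)), 0, F.zero_mem, by simp⟩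
    by_cases hβ0 : β = 0
    · subst hβ0
      exact ⟨α⁻¹, F.inv_mem hα, 0, F.zero_mem, by simp⟩
    have hplus : α + β * s ≠ 0 := fun h => hsF <| by
      have : s = -α / β := by field_simp; linear_combination h
      exact this ▸ F.div_mem (F.neg_mem hα) hβ
    have hminus : α - β * s ≠ 0 := fun h => hsF <| by
      have : s = α / β := by field_simp; linear_combination -h
      exact this ▸ F.div_mem hα hβ
    have hN : α ^ 2 - β ^ 2 * s ^ 2 ∈ F :=
      F.sub_mem (F.pow_mem hα 2) (F.mul_mem (F.pow_mem hβ 2) hs)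
    have hN0 : α ^ 2 - β ^ 2 * s ^ 2 ≠ 0 := by
      rw [show α ^ 2 - β ^ 2 * s ^ 2 = (α + β * s) * (α - β * s) by ring]
      exact mul_ne_zero hplus hminus
    refine ⟨α / (α ^ 2 - β ^ 2 * s ^ 2), F.div_mem hα hN,
      -β / (α ^ 2 - β ^ 2 * s ^ 2), F.div_mem (F.neg_mem hβ) hN, ?_⟩
    rw [inv_eq_of_mul_eq_one_right]
    field_simp
    ring

/-- Quadratic Kummer theory: an element of `F(s i : i ∈ T)` whose square lies in `F` lies in `F`
after multiplication by a product of some of the `s i`. -/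
theorem Subfield.exists_adjoin_sqrts {L ι : Type*} [Field L] [DecidableEq ι]
    (h2 : (2 : L) ≠ 0) (F : Subfield L) (s : ι → L) (hs : ∀ i, s i ^ 2 ∈ F) (T : Finset ι) :
    ∃ F' : Subfield L, F ≤ F' ∧ (∀ i ∈ T, s i ∈ F') ∧
      ∀ t ∈ F', t ^ 2 ∈ F → ∃ S ⊆ T, t * ∏ i ∈ S, s i ∈ F := by
  induction T using Finset.induction_on with
  | empty => exact ⟨F, le_rfl, by simp, fun t ht _ => ⟨∅, by simp, by simpa using ht⟩⟩
  | insert k T hk ih =>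
    obtain ⟨E, hFE, hsE, hE⟩ := ih
    obtain ⟨E', hEE', hkE', hE'⟩ := E.exists_adjoin_sqrt (hFE (hs k))
    refine ⟨E', hFE.trans hEE', ?_, fun t ht htF => ?_⟩
    · intro i hi
      rcases Finset.mem_insert.1 hi with rfl | hi
      · exact hkE'
      · exact hEE' (hsE i hi)
    have key : t ∈ E → ∃ S ⊆ insert k T, t * ∏ i ∈ S, s i ∈ F := fun htE => by
      obtain ⟨S, hS, h⟩ := hE t htE htF
      exact ⟨S, hS.trans (Finset.subset_insert _ _), h⟩
    obtain ⟨α, hα, β, hβ, rfl⟩ := hE' t ht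
    by_cases hα0 : α = 0
    · subst hα0
      have hmem : β * s k ^ 2 ∈ E := E.mul_mem hβ (hFE (hs k))
      obtain ⟨S, hS, h⟩ := hE _ hmem <| by
        rw [show (β * s k ^ 2) ^ 2 = (0 + β * s k) ^ 2 * s k ^ 2 by ring]
        exact F.mul_mem htF (hs k)
      refine ⟨insert k S, Finset.insert_subset_insert _ hS, ?_⟩
      rw [Finset.prod_insert fun hkS => hk (hS hkS)]
      convert h using 1
      ring
    by_cases hβ0 : β = 0
    · exact key (by simpa [hβ0] using hα)
    have hsk : s k ∈ E := by
      have : s k = ((α + β * s k) ^ 2 - α ^ 2 - β ^ 2 * s k ^ 2) / (2 * α * β) := by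
        field_simp
        ring
      rw [this]
      refine E.div_mem (E.sub_mem (E.sub_mem (hFE htF) (E.pow_mem hα 2))
        (E.mul_mem (E.pow_mem hβ 2) (hFE (hs k)))) (E.mul_mem (E.mul_mem ?_ hα) hβ)
      exact ofNat_mem E 2
    exact key (E.add_mem hα (E.mul_mem hβ hsk))

/-- If `x = (u + s) / b` and `x⁻¹ = (u - s) / b`, then the integral powers of `x` have the form
`α + β * s`, with inverse `α - β * s`. -/
theorem Subfield.exists_zpow_eq_add_mul {L : Type*} [Field L] (F : Subfield L) {x s u b : L}
    (hu : u ∈ F) (hb : b ∈ F) (hs : s ^ 2 ∈ F) (hx : x = (u + s) / b) (hx' : x⁻¹ = (u - s) / b)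
    (n : ℤ) : ∃ α ∈ F, ∃ β ∈ F, x ^ n = α + β * s ∧ (x ^ n)⁻¹ = α - β * s := by
  have hnat (m : ℕ) : ∃ α ∈ F, ∃ β ∈ F, x ^ m = α + β * s ∧ (x ^ m)⁻¹ = α - β * s := by
    induction m with
    | zero => exact ⟨1, F.one_mem, 0, F.zero_mem, by simp, by simp⟩
    | succ m ih =>
      obtain ⟨α, hα, β, hβ, h1, h2⟩ := ih
      refine ⟨(α * u + β * s ^ 2) / b,
        F.div_mem (F.add_mem (F.mul_mem hα hu) (F.mul_mem hβ hs)) hb,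
        (α + β * u) / b, F.div_mem (F.add_mem hα (F.mul_mem hβ hu)) hb, ?_, ?_⟩
      · rw [pow_succ, h1, hx]; ring
      · rw [pow_succ, mul_inv, h2, hx']; ring
  obtain ⟨m, rfl | rfl⟩ := n.eq_nat_or_neg
  · simpa using hnat m
  · obtain ⟨α, hα, β, hβ, h1, h2⟩ := hnat m
    refine ⟨α, hα, -β, F.neg_mem hβ, ?_, ?_⟩
    · rw [zpow_neg, zpow_natCast, h2]; ring
    · rw [zpow_neg, zpow_natCast, inv_inv, h1]; ring

open Polynomial in
/-- A product of distinct polynomials `X² - 4aᵢ²` is not a square in `ℚ(X)`. -/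
theorem Polynomial.sq_ne_sq_mul_prod {ι : Type*} [DecidableEq ι] {a : ι → ℤ} (ha : ∀ i, a i ≠ 0)
    (hdist : ∀ i j, i ≠ j → a i ≠ a j ∧ a i ≠ -a j) {k : ι} {S : Finset ι} (hk : k ∈ S)
    {g h : ℤ[X]} (hh : h ≠ 0) :
    g ^ 2 ≠ h ^ 2 * ∏ i ∈ S, (X ^ 2 - C (4 * a i ^ 2)) := by
  intro heq
  set Q : ℤ[X] := (X + C (2 * a k)) * ∏ i ∈ S.erase k, (X ^ 2 - C (4 * a i ^ 2)) with hQ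
  have hQ0 : Q.eval (2 * a k) ≠ 0 := by
    rw [hQ, eval_mul, eval_prod]
    refine mul_ne_zero (by simpa [← two_mul] using ha k) (Finset.prod_ne_zero_iff.2 ?_)
    intro i hi h0
    have hik := hdist k i (Finset.ne_of_mem_erase hi).symm
    simp only [eval_sub, eval_pow, eval_X, eval_C] at h0
    have : (a k - a i) * (a k + a i) = 0 := by linarith
    rcases mul_eq_zero.1 this with h | h
    · exact hik.1 (by linarith)
    · exact hik.2 (by linarith)
  have hP : ∏ i ∈ S, (X ^ 2 - C (4 * a i ^ 2)) = (X - C (2 * a k)) * Q := by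
    rw [hQ, ← Finset.mul_prod_erase _ _ hk, ← mul_assoc]
    congr 1
    simp only [map_mul, map_pow, map_ofNat]
    ring
  have hQne : Q ≠ 0 := fun h0 => hQ0 (by simp [h0])
  have hXne : (X - C (2 * a k) : ℤ[X]) ≠ 0 := X_sub_C_ne_zero _
  have hg : g ^ 2 ≠ 0 := by
    rw [heq, hP]
    exact mul_ne_zero (pow_ne_zero 2 hh) (mul_ne_zero hXne hQne)
  have hroot := congrArg (rootMultiplicity (2 * a k)) heq
  rw [hP, rootMultiplicity_mul (by rw [← hP, ← heq]; exact hg),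
    rootMultiplicity_mul (mul_ne_zero hXne hQne), rootMultiplicity_X_sub_C_self,
    rootMultiplicity_eq_zero (p := Q) hQ0] at hroot
  have hg0 : g ≠ 0 := by rintro rfl; simp at hg
  rw [pow_two, pow_two, rootMultiplicity_mul (mul_self_ne_zero.2 hg0),
    rootMultiplicity_mul (mul_self_ne_zero.2 hh)] at hroot
  omega

/-- The `R`-valued points of the scheme defined by the equations of `Yset₀`. -/
def torusSolutions {ι : Type*} [Fintype ι] (R : Type*) [CommRing R] (a n : ι → ℤ) :
    Set (ι → Rˣ) :=
  {x | (∀ i j, (a i : R) * ((x i : R) + ((x i)⁻¹ : Rˣ)) = a j * ((x j : R) + ((x j)⁻¹ : Rˣ))) ∧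
    ∏ i, x i ^ n i = 1}

theorem map_mem_torusSolutions {ι R R' : Type*} [Fintype ι] [CommRing R] [CommRing R']
    {a n : ι → ℤ} (f : R →+* R') {x : ι → Rˣ} (hx : x ∈ torusSolutions R a n) :
    (fun i => Units.map (f : R →* R') (x i)) ∈ torusSolutions R' a n := by
  refine ⟨fun i j => ?_, ?_⟩
  · simpa [← map_inv] using congrArg f (hx.1 i j)
  · simpa using congrArg (Units.map (f : R →* R')) hx.2

open Polynomial in
/-- Over a field of characteristic zero every point of `torusSolutions` has algebraic
coordinates. -/
theorem isAlgebraic_of_mem_torusSolutions_field {ι L : Type*} [Fintype ι] [DecidableEq ι]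
    [Field L] [CharZero L]
    {a n : ι → ℤ} (ha : ∀ i, a i ≠ 0) (hdist : ∀ i j, i ≠ j → a i ≠ a j ∧ a i ≠ -a j)
    {x : ι → Lˣ} (hx : x ∈ torusSolutions L a n) {k : ι} (hn : n k ≠ 0) :
    IsAlgebraic ℤ (x k : L) := by
  by_contra htr
  set u : L := a k * ((x k : L) + ((x k)⁻¹ : Lˣ)) with hu
  set s : ι → L := fun i => a i * ((x i : L) - ((x i)⁻¹ : Lˣ)) with hs
  have haL (i : ι) : (a i : L) ≠ 0 := Int.cast_ne_zero.2 (ha i)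
  have hxu (i : ι) : (x i : L) = (u + s i) / (2 * a i) := by
    have := hx.1 k i
    have h := haL i
    field_simp
    simp only [hu, hs, this]
    ring
  have hxu' (i : ι) : (x i : L)⁻¹ = (u - s i) / (2 * a i) := by
    have := hx.1 k i
    have h := haL i
    rw [eq_div_iff (by simpa using h)]
    simp only [hu, hs, Units.val_inv_eq_inv_val] at this ⊢
    linear_combination -this
  have haeval (m : ℤ) : aeval u (X ^ 2 - C m : ℤ[X]) = u ^ 2 - (m : L) := by
    rw [map_sub, map_pow, aeval_X, aeval_C, algebraMap_int_eq, eq_intCast]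
  have hs2 (i : ι) : s i ^ 2 = aeval u (X ^ 2 - C (4 * a i ^ 2) : ℤ[X]) := by
    have h1 := hxu i
    have h2 := hxu' i
    have h := haL i
    have h3 : ((u + s i) / (2 * a i)) * ((u - s i) / (2 * a i)) = 1 := by
      rw [← h1, ← h2, mul_inv_cancel₀ (x i).ne_zero]
    field_simp at h3
    rw [haeval]
    push_cast
    linear_combination -h3
  have halgInt (m : ℤ) : IsAlgebraic ℤ (m : L) := isAlgebraic_algebraMap (R := ℤ) (A := L) m
  have hutr : Transcendental ℤ u := by
    intro hualg
    apply htr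
    have hsk : IsAlgebraic ℤ (s k) := by
      refine IsAlgebraic.of_pow (n := 2) two_pos ?_
      rw [hs2 k, haeval]
      exact (hualg.pow 2).sub (halgInt (4 * a k ^ 2))
    rw [hxu k, div_eq_mul_inv]
    refine (hualg.add hsk).mul (IsAlgebraic.inv ?_)
    simpa using halgInt (2 * a k)
  have hinj : Function.Injective (aeval u : ℤ[X] →ₐ[ℤ] L) :=
    transcendental_iff_injective.1 hutr
  set φ : ℤ[X] →+* L := (aeval u : ℤ[X] →ₐ[ℤ] L).toRingHom with hφ
  have hφX : φ X = u := by simp [hφ]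
  set K : Subfield L := Subfield.closure (φ.range : Set L) with hK
  have hφK (f : ℤ[X]) : φ f ∈ K := Subfield.subset_closure ⟨f, rfl⟩
  have huK : u ∈ K := hφX ▸ hφK X
  have hsK (i : ι) : s i ^ 2 ∈ K := by rw [hs2 i]; exact hφK _
  obtain ⟨E, hKE, hsE, hE⟩ :=
    K.exists_adjoin_sqrts two_ne_zero s hsK (Finset.univ.erase k)
  have hskE : s k ∉ E := by
    intro hmem
    obtain ⟨S, hS, hSK⟩ := hE _ hmem (hsK k)
    have hkS : k ∉ S := fun h => Finset.notMem_erase _ _ (hS h)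
    rw [← Finset.prod_insert hkS, hK, Subfield.mem_closure_iff, Subring.closure_eq] at hSK
    obtain ⟨_, ⟨g, rfl⟩, _, ⟨h, rfl⟩, hgh⟩ := hSK
    obtain ⟨g, h, hh, hgh⟩ : ∃ g h : ℤ[X], h ≠ 0 ∧ φ g = φ h * ∏ i ∈ insert k S, s i := by
      by_cases h0 : h = 0
      · refine ⟨0, 1, one_ne_zero, ?_⟩
        rw [← hgh, h0]
        simp
      · have : φ h ≠ 0 := fun h' => h0 (hinj (by simpa [hφ] using h'))
        exact ⟨g, h, h0, by rw [← hgh]; field_simp⟩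
    refine Polynomial.sq_ne_sq_mul_prod (g := g) ha hdist (Finset.mem_insert_self k S) hh
      (hinj ?_)
    change φ _ = φ _
    rw [map_pow, hgh, mul_pow, ← Finset.prod_pow, map_mul, map_pow, map_prod]
    congr 1
    exact Finset.prod_congr rfl fun i _ => hs2 i
  have hxE : ((x k : L) ^ n k) ∈ E := by
    have h := congrArg (Units.val) hx.2
    rw [← Finset.mul_prod_erase _ _ (Finset.mem_univ k)] at h
    simp only [Units.val_mul, Units.val_zpow_eq_zpow_val, Units.coe_prod, Units.val_one] at h
    rw [eq_inv_of_mul_eq_one_left h]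
    refine E.inv_mem (prod_mem fun i hi => zpow_mem ?_ _)
    rw [hxu i]
    exact E.div_mem (E.add_mem (hKE huK) (hsE i hi)) (E.mul_mem (ofNat_mem E 2) (intCast_mem E _))
  obtain ⟨α, hα, β, hβ, h1, h2⟩ := K.exists_zpow_eq_add_mul huK
    (K.mul_mem (ofNat_mem K 2) (intCast_mem K (a k))) (hsK k) (hxu k) (hxu' k) (n k)
  have hβ0 : β = 0 := by
    by_contra hβ0
    apply hskE
    have : s k = ((x k : L) ^ n k - α) / β := by rw [h1]; field_simp; ring
    rw [this]
    exact E.div_mem (E.sub_mem hxE (hKE hα)) (hKE hβ)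
  have hpow : (x k : L) ^ n k * (x k : L) ^ n k = 1 := by
    have h3 : (x k : L) ^ n k = ((x k : L) ^ n k)⁻¹ := by rw [h2, h1, hβ0]; ring
    nth_rewrite 2 [h3]
    exact mul_inv_cancel₀ (zpow_ne_zero _ (x k).ne_zero)
  apply htr
  refine IsAlgebraic.of_pow (n := 2 * (n k).natAbs) (by positivity) ?_
  have : (x k : L) ^ (2 * (n k).natAbs) = 1 := by
    rw [two_mul, pow_add]
    rcases Int.natAbs_eq (n k) with h | h
    · rw [h, zpow_natCast] at hpow
      exact hpow
    · rw [h, zpow_neg, zpow_natCast, ← mul_inv, inv_eq_one] at hpow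
      exact hpow
  rw [this]
  simpa using halgInt 1

open Polynomial in
/-- Over any commutative ring the coordinates of a point of `torusSolutions` are algebraic over
`ℤ`: otherwise some quotient domain of characteristic zero has a point with a transcendental
coordinate. -/
theorem isAlgebraic_of_mem_torusSolutions {ι A : Type*} [Fintype ι] [CommRing A]
    {a n : ι → ℤ} (ha : ∀ i, a i ≠ 0) (hdist : ∀ i j, i ≠ j → a i ≠ a j ∧ a i ≠ -a j)
    {x : ι → Aˣ} (hx : x ∈ torusSolutions A a n) {k : ι} (hn : n k ≠ 0) :
    IsAlgebraic ℤ (x k : A) := by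
  classical
  by_contra htr
  have hinj : Function.Injective (aeval (x k : A) : ℤ[X] →ₐ[ℤ] A) :=
    transcendental_iff_injective.1 htr
  let S : Submonoid A := (nonZeroDivisors ℤ[X]).map (aeval (x k : A) : ℤ[X] →ₐ[ℤ] A)
  obtain ⟨P, hP, -, hPS⟩ := Ideal.exists_le_prime_disjoint (⊥ : Ideal A) S <| by
    rw [Set.disjoint_left]
    rintro y hy ⟨f, hf, rfl⟩
    have hy0 : aeval (x k : A) f = 0 := by simpa using hy
    exact nonZeroDivisors.ne_zero hf (hinj (by simpa using hy0))
  let L := FractionRing (A ⧸ P)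
  let ψ : A →+* L := (algebraMap (A ⧸ P) L).comp (Ideal.Quotient.mk P)
  have hψ (f : ℤ[X]) (hf : ψ (aeval (x k : A) f) = 0) : f = 0 := by
    by_contra hf0
    refine Set.disjoint_left.1 hPS ?_ ⟨f, mem_nonZeroDivisors_of_ne_zero hf0, rfl⟩
    have : Ideal.Quotient.mk P (aeval (x k : A) f) = 0 :=
      IsFractionRing.injective (A ⧸ P) L (by simpa [ψ] using hf)
    exact Ideal.Quotient.eq_zero_iff_mem.1 this
  have : CharZero L := charZero_of_inj_zero fun m hm => by
    have := hψ (C (m : ℤ)) (by simpa [ψ] using hm)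
    simpa using this
  obtain ⟨f, hf, hf0⟩ := isAlgebraic_of_mem_torusSolutions_field ha hdist
    (map_mem_torusSolutions ψ hx) hn
  refine hf (hψ f ?_)
  have h0 : eval₂ (Int.castRingHom L) (ψ (x k)) f = 0 := hf0
  rw [aeval_def, hom_eval₂, ← h0]
  congr 1
  exact RingHom.ext_int _ _

open Polynomial in
/-- The coordinates of all points of `torusSolutions` over all the rings `ZMod q` are roots of a
single nonzero integer polynomial. -/
theorem exists_polynomial_torusSolutions_zmod {ι : Type*} [Fintype ι]
    {a n : ι → ℤ} (ha : ∀ i, a i ≠ 0) (hdist : ∀ i j, i ≠ j → a i ≠ a j ∧ a i ≠ -a j)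
    {k : ι} (hn : n k ≠ 0) :
    ∃ f : ℤ[X], f ≠ 0 ∧ ∀ q : ℕ, ∀ x ∈ torusSolutions (ZMod q) a n,
      (f.map (Int.castRingHom (ZMod q))).IsRoot (x k : ZMod q) := by
  let A := ∀ t : Σ q : ℕ, torusSolutions (ZMod q) a n, ZMod t.1
  let X₀ : ι → Aˣ := fun i => MulEquiv.piUnits.symm fun t => t.2.1 i
  have hX₀ : X₀ ∈ torusSolutions A a n := by
    refine ⟨fun i j => funext fun t => t.2.2.1 i j, ?_⟩
    apply MulEquiv.piUnits.injective
    funext t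
    simpa [X₀] using t.2.2.2
  obtain ⟨f, hf, hf0⟩ := isAlgebraic_of_mem_torusSolutions ha hdist hX₀ hn
  refine ⟨f, hf, fun q x hx => ?_⟩
  have := congrArg (Pi.evalRingHom (fun t : Σ q : ℕ, torusSolutions (ZMod q) a n => ZMod t.1)
    ⟨q, x, hx⟩) hf0
  rw [aeval_def, hom_eval₂, map_zero] at this
  rw [IsRoot.def, eval_map, ← this]
  congr 1

theorem ZMod.isUnit_of_castHom_ne_zero {p l : ℕ} [Fact p.Prime] (hp : p ∣ p ^ l)
    {t : ZMod (p ^ l)} (ht : ZMod.castHom hp (ZMod p) t ≠ 0) : IsUnit t := by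
  have : NeZero (p ^ l) := ⟨pow_ne_zero _ (Fact.out : p.Prime).ne_zero⟩
  rw [← ZMod.natCast_zmod_val t, ZMod.isUnit_iff_coprime]
  refine Nat.Coprime.pow_right _ (Nat.Coprime.symm ?_)
  rw [(Fact.out : p.Prime).coprime_iff_not_dvd, ← ZMod.natCast_eq_zero_iff]
  rwa [← ZMod.natCast_zmod_val t, map_natCast] at ht

/-- A point modulo `p ^ l` is determined by its reduction modulo `p` and one coordinate `k`, when
no other coordinate of the reduction is `±1`. -/
theorem eq_of_mem_torusSolutions_of_castHom_eq {ι : Type*} [Fintype ι] {a n : ι → ℤ} {p l : ℕ}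
    [Fact p.Prime] (hp : p ∣ p ^ l) (hap : ∀ i, (a i : ZMod p) ≠ 0) {x y : ι → (ZMod (p ^ l))ˣ}
    (hx : x ∈ torusSolutions _ a n) (hy : y ∈ torusSolutions _ a n)
    (hxy : ∀ i, ZMod.castHom hp (ZMod p) (x i) = ZMod.castHom hp (ZMod p) (y i)) {k : ι}
    (hk : ∀ i, i ≠ k → (ZMod.castHom hp (ZMod p) (x i)) ^ 2 ≠ 1) (hxyk : x k = y k) : x = y := by
  funext i
  by_cases hik : i = k
  · rwa [hik]
  have h : (a i : ZMod (p ^ l)) * ((x i : ZMod (p ^ l)) + ((x i)⁻¹ : (ZMod (p ^ l))ˣ)) =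
      a i * ((y i : ZMod (p ^ l)) + ((y i)⁻¹ : (ZMod (p ^ l))ˣ)) := by
    rw [hx.1 i k, hy.1 i k, hxyk]
  have hai : IsUnit (a i : ZMod (p ^ l)) :=
    ZMod.isUnit_of_castHom_ne_zero hp (by simpa using hap i)
  have hu : IsUnit ((x i : ZMod (p ^ l)) * y i - 1) := by
    refine ZMod.isUnit_of_castHom_ne_zero hp ?_
    rw [map_sub, map_mul, map_one, ← hxy i, ← pow_two]
    exact sub_ne_zero.2 (hk i hik)
  have h' := hai.mul_left_cancel h
  have h0 : ((x i : ZMod (p ^ l)) - y i) * ((x i : ZMod (p ^ l)) * y i - 1) = 0 := by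
    linear_combination ((x i : ZMod (p ^ l)) * y i) * h' -
      (y i : ZMod (p ^ l)) * (x i).mul_inv + (x i : ZMod (p ^ l)) * (y i).mul_inv
  exact Units.ext (sub_eq_zero.1 (hu.mul_left_eq_zero.1 h0))

theorem ZMod.eq_of_castHom_eq_of_val_div_eq {p l : ℕ} [NeZero p] (hp : p ∣ p ^ l)
    {s t : ZMod (p ^ l)} (h : ZMod.castHom hp (ZMod p) s = ZMod.castHom hp (ZMod p) t)
    (hdiv : s.val / p = t.val / p) : s = t := by
  have : NeZero (p ^ l) := ⟨pow_ne_zero _ (NeZero.ne p)⟩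
  apply ZMod.val_injective
  have hmod : s.val % p = t.val % p := by
    rw [← ZMod.natCast_zmod_val s, ← ZMod.natCast_zmod_val t, map_natCast, map_natCast,
      ZMod.natCast_eq_natCast_iff'] at h
    exact h
  rw [← Nat.div_add_mod s.val p, hdiv, hmod, Nat.div_add_mod]

/-- At most one coordinate of a point over a field is `±1`. -/
theorem exists_forall_ne_sq_ne_one {ι K : Type*} [Fintype ι] [Nonempty ι] [Field K]
    {a n : ι → ℤ} (hsep : ∀ i j, i ≠ j → ((4 * (a i ^ 2 - a j ^ 2) : ℤ) : K) ≠ 0)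
    {x : ι → Kˣ} (hx : x ∈ torusSolutions K a n) :
    ∃ k, ∀ i, i ≠ k → (x i : K) ^ 2 ≠ 1 := by
  by_cases h : ∃ k, (x k : K) ^ 2 = 1
  · obtain ⟨k, hk⟩ := h
    refine ⟨k, fun i hik hi => hsep i k hik ?_⟩
    have hinv (j : ι) (hj : (x j : K) ^ 2 = 1) : (((x j)⁻¹ : Kˣ) : K) = x j := by
      rw [Units.val_inv_eq_inv_val]
      exact inv_eq_of_mul_eq_one_right (by rw [← pow_two, hj])
    have h := hx.1 i k
    rw [hinv i hi, hinv k hk] at h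
    push_cast
    linear_combination (2 * a i * (x i : K) + 2 * a k * x k) * h - 4 * (a i : K) ^ 2 * hi +
      4 * (a k : K) ^ 2 * hk
  · push Not at h
    exact ⟨Classical.arbitrary ι, fun i _ => h i⟩

/-- Each point modulo `p` has at most `p ^ (l - 1)` lifts modulo `p ^ l`. -/
theorem ncard_torusSolutions_zmod_pow_le {ι : Type*} [Fintype ι] [Nonempty ι] [DecidableEq ι]
    {a n : ι → ℤ} {p l : ℕ} [Fact p.Prime] (hl : 1 ≤ l) (hap : ∀ i, (a i : ZMod p) ≠ 0)
    (hsep : ∀ i j, i ≠ j → ((4 * (a i ^ 2 - a j ^ 2) : ℤ) : ZMod p) ≠ 0)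
    (W : ι → Finset (ZMod p)) (hW : ∀ x ∈ torusSolutions (ZMod p) a n, ∀ i, (x i : ZMod p) ∈ W i) :
    (torusSolutions (ZMod (p ^ l)) a n).ncard ≤ (∏ i, (W i).card) * p ^ (l - 1) := by
  have hp0 : 0 < p := (Fact.out : p.Prime).pos
  have : NeZero p := ⟨hp0.ne'⟩
  have : NeZero (p ^ l) := ⟨pow_ne_zero _ hp0.ne'⟩
  have hp : p ∣ p ^ l := dvd_pow_self p (by omega)
  let red (x : ι → (ZMod (p ^ l))ˣ) : ι → ZMod p := fun i => ZMod.castHom hp (ZMod p) (x i)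
  have hred {x} (hx : x ∈ torusSolutions (ZMod (p ^ l)) a n) :=
    map_mem_torusSolutions (ZMod.castHom hp (ZMod p)) hx
  have hJ (y : ι → ZMod p) : ∃ k, ∀ x ∈ torusSolutions (ZMod (p ^ l)) a n, red x = y →
      ∀ i, i ≠ k → (y i) ^ 2 ≠ 1 := by
    by_cases h : ∃ x ∈ torusSolutions (ZMod (p ^ l)) a n, red x = y
    · obtain ⟨x, hx, rfl⟩ := h
      obtain ⟨k, hk⟩ := exists_forall_ne_sq_ne_one hsep (hred hx)
      exact ⟨k, fun _ _ _ => hk⟩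
    · exact ⟨Classical.arbitrary ι, fun x hx hxy => (h ⟨x, hx, hxy⟩).elim⟩
  choose J hJ using hJ
  let Φ (x : ι → (ZMod (p ^ l))ˣ) : (ι → ZMod p) × ℕ :=
    (red x, (x (J (red x)) : ZMod (p ^ l)).val / p)
  have hcard : (Fintype.piFinset W ×ˢ Finset.range (p ^ (l - 1))).card =
      (∏ i, (W i).card) * p ^ (l - 1) := by
    rw [Finset.card_product, Fintype.card_piFinset, Finset.card_range]
  rw [← hcard, ← Set.ncard_coe_finset]
  refine Set.ncard_le_ncard_of_injOn Φ (fun x hx => ?_) (fun x hx y hy hxy => ?_)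
    (Finset.finite_toSet _)
  · rw [Finset.mem_coe, Finset.mem_product, Fintype.mem_piFinset, Finset.mem_range]
    refine ⟨fun i => hW _ (hred hx) i, Nat.div_lt_of_lt_mul ?_⟩
    rw [← pow_succ', Nat.sub_add_cancel hl]
    exact ZMod.val_lt _
  · obtain ⟨h1, h2⟩ := Prod.mk.inj hxy
    rw [← h1] at h2
    exact eq_of_mem_torusSolutions_of_castHom_eq hp hap hx hy (congrFun h1) (hJ _ x hx rfl)
      (Units.ext (ZMod.eq_of_castHom_eq_of_val_div_eq hp (congrFun h1 _) h2))

theorem ZMod.eventually_intCast_ne_zero {m : ℤ} (hm : m ≠ 0) :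
    ∀ᶠ p : ℕ in Filter.atTop, (m : ZMod p) ≠ 0 := by
  filter_upwards [Filter.eventually_gt_atTop m.natAbs] with p hp h
  rw [ZMod.intCast_zmod_eq_zero_iff_dvd, Int.natCast_dvd] at h
  exact hp.not_ge (Nat.le_of_dvd (Int.natAbs_pos.2 hm) h)

/-- For fixed distinct nonzero integers `a₁,…,a_r` (`a_i ≠ ±a_j` for `i ≠ j`) and fixed
nonzero integers `n₁,…,n_r`, one has `#Y₀(p^l) = O(p^{l-1})`: there is a constant `C`
such that `#Y₀(p^l) ≤ C·p^{l-1}` for all sufficiently large primes `p` and all `l ≥ 1`. -/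
theorem card_Yset₀_bound
    (r : ℕ) (hr : 0 < r) (a : Fin r → ℤ) (ha : ∀ i, a i ≠ 0)
    (hdist : ∀ i j, i ≠ j → a i ≠ a j ∧ a i ≠ -a j)
    (n : Fin r → ℤ) (hn : ∀ i, n i ≠ 0) :
    ∃ C : ℝ, 0 < C ∧ ∃ N : ℕ, ∀ p : ℕ, p.Prime → N < p → ∀ l : ℕ, 1 ≤ l →
      ((Yset₀ p l r hr a n).ncard : ℝ) ≤ C * (p : ℝ) ^ (l - 1) := by
  have : Nonempty (Fin r) := ⟨⟨0, hr⟩⟩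
  choose f hf hroot using fun k => exists_polynomial_torusSolutions_zmod ha hdist (hn k)
  have hsep (i j : Fin r) (hij : i ≠ j) : 4 * (a i ^ 2 - a j ^ 2) ≠ 0 := by
    have h := hdist i j hij
    refine mul_ne_zero four_ne_zero (sub_ne_zero.2 fun h' => ?_)
    rcases sq_eq_sq_iff_eq_or_eq_neg.1 h' with h' | h'
    exacts [h.1 h', h.2 h']
  obtain ⟨N, hN⟩ := Filter.eventually_atTop.1 <|
    (Filter.eventually_all.2 fun i => ZMod.eventually_intCast_ne_zero (ha i)).and <|
    (Filter.eventually_all.2 fun i => Filter.eventually_all.2 fun j =>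
      Filter.eventually_all.2 fun hij => ZMod.eventually_intCast_ne_zero (hsep i j hij)).and
    (Filter.eventually_all.2 fun i =>
      ZMod.eventually_intCast_ne_zero (Polynomial.leadingCoeff_ne_zero.2 (hf i)))
  refine ⟨(∏ i, (f i).natDegree : ℕ) + 1, by positivity, N, fun p hp hNp l hl => ?_⟩
  have : Fact p.Prime := ⟨hp⟩
  obtain ⟨hap, hsepp, hlead⟩ := hN p hNp.le
  have hsub : Yset₀ p l r hr a n ⊆ torusSolutions (ZMod (p ^ l)) a n :=
    fun x hx => ⟨fun i j => (hx.1 i).symm.trans (hx.1 j), hx.2⟩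
  have hfp (i : Fin r) : (f i).map (Int.castRingHom (ZMod p)) ≠ 0 := fun h => hlead i <| by
    simpa using congrArg (fun g => Polynomial.coeff g (f i).natDegree) h
  have : NeZero (p ^ l) := ⟨pow_ne_zero _ hp.ne_zero⟩
  have hcard := (Set.ncard_le_ncard hsub (Set.toFinite _)).trans <|
    ncard_torusSolutions_zmod_pow_le hl hap hsepp
      (fun i => ((f i).map (Int.castRingHom (ZMod p))).roots.toFinset)
      (fun x hx i => by simpa [hfp i] using hroot i p x hx)
  have hdeg : ∏ i, ((f i).map (Int.castRingHom (ZMod p))).roots.toFinset.card ≤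
      ∏ i, (f i).natDegree :=
    Finset.prod_le_prod' fun i _ => (Multiset.toFinset_card_le _).trans <|
      (Polynomial.card_roots' _).trans Polynomial.natDegree_map_le
  have hle : (Yset₀ p l r hr a n).ncard ≤ (∏ i, (f i).natDegree + 1) * p ^ (l - 1) :=
    hcard.trans (Nat.mul_le_mul_right _ (hdeg.trans (Nat.le_succ _)))
  exact_mod_cast hle
end

section
/- Let a_1, …, a_r be nonzero integers with a_i² ≠ a_j² for all i ≠ j. Then there is a constant C (depending only on a_1,…,a_r) such that for every odd prime p not dividing a_1⋯a_r·∏_{i<j}(a_i² − a_j²), the quantity N(p) = #{t ∈ ℤ/pℤ : t² − 4a_j² is a nonzero quadratic residue mod p for every j} satisfies |2^r·N(p) − p| ≤ C·√p. -/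
open Finset

section
open Polynomial

/-- The linear operator for which the `k`-th derivative of `r * f ^ n` equals `f ^ (n - k)` times
its value at `r`, for `k ≤ n`. -/
noncomputable def twistedDerivative {F : Type*} [Field F] (f : F[X]) (n : ℕ) :
    ℕ → F[X] →ₗ[F] F[X]
  | 0 => LinearMap.id
  | k + 1 => (LinearMap.mulLeft F f ∘ₗ derivative +
      LinearMap.mulLeft F (((n - k : ℕ) : F[X]) * derivative f)) ∘ₗ twistedDerivative f n k

section
variable {F : Type*} [Field F]

lemma iterate_derivative_mul_pow (f r : F[X]) {n k : ℕ} (hk : k ≤ n) :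
    derivative^[k] (r * f ^ n) = f ^ (n - k) * twistedDerivative f n k r := by
  induction k with
  | zero => simp [twistedDerivative, mul_comm]
  | succ k ih =>
    rw [Function.iterate_succ_apply', ih (by omega)]
    obtain ⟨i, rfl⟩ : ∃ i, n = k + 1 + i := ⟨n - (k + 1), by omega⟩
    have h1 : k + 1 + i - k = i + 1 := by omega
    have h2 : k + 1 + i - (k + 1) = i := by omega
    simp only [twistedDerivative, h1, h2, derivative_mul, derivative_pow, LinearMap.comp_apply,
      LinearMap.add_apply, LinearMap.mulLeft_apply, Nat.add_sub_cancel, map_natCast]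
    ring

lemma natDegree_twistedDerivative_le (f r : F[X]) {n m d : ℕ} (hf : f.natDegree ≤ m)
    (hr : r.natDegree ≤ d) (k : ℕ) : (twistedDerivative f n k r).natDegree ≤ d + k * m := by
  induction k with
  | zero => simpa [twistedDerivative] using hr
  | succ k ih =>
    simp only [twistedDerivative, LinearMap.comp_apply, LinearMap.add_apply,
      LinearMap.mulLeft_apply]
    have h1 := natDegree_derivative_le (twistedDerivative f n k r)
    have h2 := natDegree_derivative_le f
    refine (natDegree_add_le_of_degree_le (n := d + (k + 1) * m) ?_ ?_)
    · refine natDegree_mul_le.trans ?_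
      rw [add_mul]; omega
    · rw [mul_assoc]
      refine natDegree_mul_le.trans ?_
      rw [natDegree_natCast]
      have := natDegree_mul_le (p := derivative f) (q := twistedDerivative f n k r)
      rw [add_mul]; omega

lemma iterate_derivative_mul_of_derivative_eq_zero (u : F[X]) {v : F[X]} (hv : derivative v = 0)
    (k : ℕ) : derivative^[k] (u * v) = derivative^[k] u * v := by
  induction k with
  | zero => rfl
  | succ k ih => rw [Function.iterate_succ_apply', ih, derivative_mul, hv, mul_zero, add_zero,
      Function.iterate_succ_apply']

lemma card_mul_le_natDegree {Q : F[X]} (hQ : Q ≠ 0) (S : Finset F) (l : ℕ)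
    (h : ∀ x ∈ S, (X - C x) ^ l ∣ Q) : S.card * l ≤ Q.natDegree := by
  have hd : ∏ x ∈ S, (X - C x) ^ l ∣ Q := by
    refine Finset.prod_dvd_of_coprime (fun x _ y _ hxy => ?_) h
    exact (pairwise_coprime_X_sub_C Function.injective_id hxy).pow
  have := natDegree_le_of_dvd hd hQ
  rw [natDegree_prod _ _ (fun x _ => pow_ne_zero _ (X_sub_C_ne_zero x))] at this
  simpa using this

lemma eq_zero_of_sq_mul_eq_C_mul_sq {f h r s : F[X]} {x c : F} (hf : f = (X - C x) * h)
    (hx : h.eval x ≠ 0) (hc : c ≠ 0) (e : r ^ 2 * f = C c * s ^ 2) : r = 0 ∧ s = 0 := by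
  have hh : h ≠ 0 := by rintro rfl; simp at hx
  have hf0 : f ≠ 0 := hf ▸ mul_ne_zero (X_sub_C_ne_zero x) hh
  have hC : (C c : F[X]) ≠ 0 := C_ne_zero.mpr hc
  have hmf : rootMultiplicity x f = 1 := by
    rw [hf, rootMultiplicity_mul (hf ▸ hf0), rootMultiplicity_X_sub_C_self,
      rootMultiplicity_eq_zero hx]
  by_cases hr : r = 0
  · subst hr
    refine ⟨rfl, ?_⟩
    have : C c * s ^ 2 = 0 := by rw [← e]; ring
    simpa [hc] using this
  · have hs : s ≠ 0 := by
      rintro rfl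
      have : r ^ 2 * f ≠ 0 := mul_ne_zero (pow_ne_zero _ hr) hf0
      exact this (by rw [e]; ring)
    have := congrArg (rootMultiplicity x) e
    rw [pow_two, pow_two, rootMultiplicity_mul (by positivity),
      rootMultiplicity_mul (by positivity), rootMultiplicity_mul (by positivity),
      rootMultiplicity_mul (by positivity), hmf, rootMultiplicity_C] at this
    omega
lemma exists_sum_mul_X_pow_eq_zero (A B : ℕ → F[X] →ₗ[F] F[X])
    {d e l J : ℕ} (hA : ∀ k < l, ∀ r : F[X], r.natDegree ≤ d → (A k r).natDegree ≤ e)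
    (hB : ∀ k < l, ∀ r : F[X], r.natDegree ≤ d → (B k r).natDegree ≤ e)
    (hdim : l * (e + J) < 2 * J * (d + 1)) :
    ∃ r s : ℕ → F[X], (∀ j, (r j).natDegree ≤ d) ∧ (∀ j, (s j).natDegree ≤ d) ∧
      (∃ j < J, r j ≠ 0 ∨ s j ≠ 0) ∧
      ∀ k < l, ∑ j ∈ range J, (A k (r j) + B k (s j)) * X ^ j = 0 := by
  let V := degreeLT F (d + 1)
  let Φ : (Fin J → V × V) →ₗ[F] (Fin l → Fin (e + J) → F) :=
    LinearMap.pi fun k => LinearMap.pi fun i => lcoeff F i ∘ₗ ∑ j : Fin J,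
      LinearMap.mulRight F (X ^ (j : ℕ)) ∘ₗ (A k ∘ₗ V.subtype ∘ₗ LinearMap.fst F V V +
        B k ∘ₗ V.subtype ∘ₗ LinearMap.snd F V V) ∘ₗ LinearMap.proj j
  have : Module.Finite F V := Module.Finite.equiv (degreeLTEquiv F (d + 1)).symm
  have hV : Module.finrank F V = d + 1 := by
    rw [(degreeLTEquiv F (d + 1)).finrank_eq]; simp
  have hdom : Module.finrank F (Fin J → V × V) = J * (2 * (d + 1)) := by
    rw [Module.finrank_pi_fintype]
    simp [Module.finrank_prod, hV, two_mul]
  have hcod : Module.finrank F (Fin l → Fin (e + J) → F) = l * (e + J) := by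
    rw [Module.finrank_pi_fintype]
    simp
  have hker : Φ.ker ≠ ⊥ := by
    apply LinearMap.ker_ne_bot_of_finrank_lt
    rw [hdom, hcod]
    linarith
  obtain ⟨v, hv, hv0⟩ := (Submodule.ne_bot_iff _).mp hker
  have hdeg : ∀ w : V, (w : F[X]).natDegree ≤ d := fun w => by
    by_cases h : (w : F[X]) = 0
    · simp [h]
    · exact Nat.lt_succ_iff.mp ((natDegree_lt_iff_degree_lt h).mpr (mem_degreeLT.mp w.2))
  let r : ℕ → F[X] := fun j => if h : j < J then ((v ⟨j, h⟩).1 : F[X]) else 0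
  let s : ℕ → F[X] := fun j => if h : j < J then ((v ⟨j, h⟩).2 : F[X]) else 0
  have hrd : ∀ j, (r j).natDegree ≤ d := fun j => by
    by_cases h : j < J
    · simpa [r, h] using hdeg _
    · simp [r, h]
  have hsd : ∀ j, (s j).natDegree ≤ d := fun j => by
    by_cases h : j < J
    · simpa [s, h] using hdeg _
    · simp [s, h]
  refine ⟨r, s, hrd, hsd, ?_, fun k hk => ?_⟩
  · by_contra! h
    refine hv0 (funext fun j => ?_)
    obtain ⟨h1, h2⟩ := h j j.2
    simp only [r, s, j.2, dite_true] at h1 h2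
    exact Prod.ext (Subtype.ext h1) (Subtype.ext h2)
  · ext i
    rw [coeff_zero]
    by_cases hi : i < e + J
    · have := congrFun (congrFun (LinearMap.mem_ker.mp hv) ⟨k, hk⟩) ⟨i, hi⟩
      rw [← Fin.sum_univ_eq_sum_range (fun j => (A k (r j) + B k (s j)) * X ^ j)]
      simpa [Φ, r, s] using this
    · refine coeff_eq_zero_of_natDegree_lt (lt_of_lt_of_le ?_ (not_lt.mp hi))
      have hJ : 0 < J := by
        rcases Nat.eq_zero_or_pos J with rfl | h
        · simp at hdim
        · exact h
      refine lt_of_le_of_lt (natDegree_sum_le_of_forall_le (n := e + (J - 1)) _ _ fun j hj => ?_)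
        (by omega)
      have hj := mem_range.mp hj
      refine natDegree_mul_le.trans (add_le_add ?_ ?_)
      · exact natDegree_add_le_of_degree_le (hA k hk _ (hrd j)) (hB k hk _ (hsd j))
      · rw [natDegree_X_pow]; omega
end

section
variable {p : ℕ} [Fact p.Prime]

lemma X_pow_dvd_expand_sub (f : (ZMod p)[X]) : X ^ p ∣ f ^ p - C (f.coeff 0) := by
  have h : expand (ZMod p) p f = expand (ZMod p) p (divX f) * X ^ p + C (f.coeff 0) := by
    conv_lhs => rw [← divX_mul_X_add f]
    simp
  rw [← ZMod.expand_card f, h, add_sub_cancel_right]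
  exact dvd_mul_left _ _

lemma eq_zero_of_sum_eq_zero (hp2 : p ≠ 2) {f h : (ZMod p)[X]} {x : ZMod p}
    (hf : f = (X - C x) * h) (hx : h.eval x ≠ 0) (hf0 : f.coeff 0 ≠ 0) {d m : ℕ}
    (hm : f.natDegree ≤ m) (hd : 2 * d + m < p) (J : ℕ) (r s : ℕ → (ZMod p)[X])
    (hr : ∀ j < J, (r j).natDegree ≤ d) (hs : ∀ j < J, (s j).natDegree ≤ d)
    (e : ∑ j ∈ range J, (r j + s j * f ^ (p / 2)) * X ^ (p * j) = 0) :
    ∀ j < J, r j = 0 ∧ s j = 0 := by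
  induction J generalizing r s with
  | zero => simp
  | succ J ih =>
    have hodd : 2 * (p / 2) + 1 = p := by
      have := (Fact.out : p.Prime).eq_two_or_odd
      omega
    set R := ∑ j ∈ range J, r (j + 1) * X ^ (p * j)
    set S := ∑ j ∈ range J, s (j + 1) * X ^ (p * j)
    have hsplit : ∑ j ∈ range J, (r (j + 1) + s (j + 1) * f ^ (p / 2)) * X ^ (p * j) =
        R + S * f ^ (p / 2) := by
      simp only [R, S, sum_mul, ← sum_add_distrib]
      exact sum_congr rfl fun j _ => by ring
    have e' : (r 0 + s 0 * f ^ (p / 2)) + X ^ p * (R + S * f ^ (p / 2)) = 0 := by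
      rw [← hsplit, ← e, sum_range_succ', mul_sum, add_comm]
      congr 1
      · exact sum_congr rfl fun j _ => by ring
      · simp
    have e2 : (r 0 + X ^ p * R) ^ 2 * f = (s 0 + X ^ p * S) ^ 2 * f ^ p := by
      have h1 : r 0 + X ^ p * R = -((s 0 + X ^ p * S) * f ^ (p / 2)) := by
        linear_combination e'
      have h2 : f ^ p = f ^ (p / 2) * f ^ (p / 2) * f := by
        rw [← pow_add, ← pow_succ]
        congr 1
        omega
      rw [h1, h2]
      ring
    obtain ⟨w, hw⟩ := X_pow_dvd_expand_sub f
    have hz : r 0 ^ 2 * f - C (f.coeff 0) * s 0 ^ 2 = 0 := by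
      refine eq_zero_of_dvd_of_natDegree_lt (p := X ^ p) ?_ ?_
      · refine ⟨(s 0 + X ^ p * S) ^ 2 * w + C (f.coeff 0) * (2 * s 0 * S + X ^ p * S ^ 2) -
          (2 * r 0 * R + X ^ p * R ^ 2) * f, ?_⟩
        linear_combination e2 + (s 0 + X ^ p * S) ^ 2 * hw
      · rw [natDegree_X_pow]
        have h1 := hr 0 (by omega)
        have h2 := hs 0 (by omega)
        refine lt_of_le_of_lt (natDegree_sub_le_of_le (m := 2 * d + m) (n := 2 * d + m) ?_ ?_)
          (by simpa using hd)
        · refine natDegree_mul_le.trans ?_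
          have := natDegree_pow_le (p := r 0) (n := 2)
          omega
        · refine (natDegree_C_mul_le _ _).trans ?_
          have := natDegree_pow_le (p := s 0) (n := 2)
          omega
    obtain ⟨h1, h2⟩ := eq_zero_of_sq_mul_eq_C_mul_sq hf hx hf0 (sub_eq_zero.mp hz)
    have e3 : R + S * f ^ (p / 2) = 0 := by
      rw [h1, h2] at e'
      simpa using e'
    have := ih (fun j => r (j + 1)) (fun j => s (j + 1)) (fun j hj => hr _ (by omega))
      (fun j hj => hs _ (by omega)) (hsplit.trans e3)
    rintro (_ | j) hj
    · exact ⟨h1, h2⟩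
    · exact this j (by omega)

lemma pow_dvd_of_forall_iterate_derivative {Q : (ZMod p)[X]} (hQ : Q ≠ 0) {x : ZMod p} {l : ℕ}
    (hl : l ≤ p) (h : ∀ k < l, (derivative^[k] Q).eval x = 0) : (X - C x) ^ l ∣ Q := by
  rcases l with _ | l
  · simp
  rw [← le_rootMultiplicity_iff hQ]
  refine lt_rootMultiplicity_of_isRoot_iterate_derivative_of_mem_nonZeroDivisors hQ
    (fun k hk => h k (by omega)) (mem_nonZeroDivisors_of_ne_zero ?_)
  rw [Ne, ZMod.natCast_eq_zero_iff, (Fact.out : p.Prime).dvd_factorial]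
  omega

/-- Stepanov's method for the level sets of `x ↦ f(x) ^ (p / 2)`. -/
lemma card_filter_mul_le_of_dim_lt (hp2 : p ≠ 2) {f h : (ZMod p)[X]} {x₀ : ZMod p}
    (hf : f = (X - C x₀) * h) (hx : h.eval x₀ ≠ 0) (hf0 : f.coeff 0 ≠ 0) {d m l J : ℕ}
    (hm : f.natDegree ≤ m) (hd : 2 * d + m < p) (hl : l ≤ p)
    (hdim : l * (d + l * m + J) < 2 * J * (d + 1)) (ε : ZMod p) :
    (univ.filter fun x : ZMod p => f.eval x ^ (p / 2) = ε).card * l ≤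
      l * m + d + p / 2 * m + p * J := by
  have hdeg (n : ℕ) (k : ℕ) (hk : k < l) (r : (ZMod p)[X]) (hr : r.natDegree ≤ d) :
      (twistedDerivative f n k r).natDegree ≤ d + l * m :=
    (natDegree_twistedDerivative_le f r hm hr k).trans (by gcongr)
  obtain ⟨r, s, hr, hs, ⟨j₀, hj₀, hne⟩, hrs⟩ := exists_sum_mul_X_pow_eq_zero
    (twistedDerivative f l) (fun k => ε • twistedDerivative f (l + p / 2) k) (hdeg l)
    (fun k hk r hr => (natDegree_smul_le _ _).trans (hdeg _ k hk r hr)) hdim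
  set P := ∑ j ∈ range J, (r j + s j * f ^ (p / 2)) * X ^ (p * j)
  have hP : P ≠ 0 := fun hP => by
    obtain ⟨h1, h2⟩ := eq_zero_of_sum_eq_zero hp2 hf hx hf0 hm hd J r s (fun j _ => hr j)
      (fun j _ => hs j) hP j₀ hj₀
    exact hne.elim (fun h => h h1) (fun h => h h2)
  have hfne : f ≠ 0 := by rintro rfl; simp at hf0
  have hQ : f ^ l * P ≠ 0 := mul_ne_zero (pow_ne_zero _ hfne) hP
  refine (card_mul_le_natDegree hQ _ l fun x hxS => ?_).trans ?_
  · have hxS : f.eval x ^ (p / 2) = ε := (mem_filter.mp hxS).2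
    refine pow_dvd_of_forall_iterate_derivative hQ hl fun k hk => ?_
    have hQ' : f ^ l * P =
        ∑ j ∈ range J, (r j * f ^ l + s j * f ^ (l + p / 2)) * X ^ (p * j) := by
      rw [mul_sum]
      exact sum_congr rfl fun j _ => by ring
    have hX (j : ℕ) : derivative (X ^ (p * j) : (ZMod p)[X]) = 0 := by
      simp [derivative_X_pow]
    have hexp : l + p / 2 - k = (l - k) + p / 2 := by omega
    have hσ := congrArg (eval x) (hrs k hk)
    rw [hQ', iterate_derivative_sum, eval_finsetSum]
    rw [eval_finsetSum] at hσ
    calc _ = ∑ j ∈ range J, f.eval x ^ (l - k) * eval x ((twistedDerivative f l k (r j) +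
          (ε • twistedDerivative f (l + p / 2) k) (s j)) * X ^ j) := by
          refine sum_congr rfl fun j _ => ?_
          rw [iterate_derivative_mul_of_derivative_eq_zero _ (hX j), iterate_map_add,
            iterate_derivative_mul_pow f _ hk.le, iterate_derivative_mul_pow f _ (by omega), hexp]
          simp only [eval_mul, eval_add, eval_pow, eval_X, LinearMap.smul_apply, eval_smul,
            smul_eq_mul, pow_mul, ZMod.pow_card, pow_add, hxS]
          ring
      _ = 0 := by rw [← mul_sum, hσ, eval_zero, mul_zero]
  · refine natDegree_mul_le.trans ?_
    have h1 : (f ^ l).natDegree ≤ l * m := natDegree_pow_le.trans (by gcongr)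
    have h2 : P.natDegree ≤ d + p / 2 * m + p * J := by
      refine natDegree_sum_le_of_forall_le _ _ fun j hj => ?_
      refine natDegree_mul_le.trans (add_le_add ?_ ?_)
      · refine natDegree_add_le_of_degree_le ((hr j).trans (by omega)) ?_
        refine natDegree_mul_le.trans (add_le_add (hs j) ?_)
        exact natDegree_pow_le.trans (by gcongr)
      · rw [natDegree_X_pow]
        have := (mem_range.mp hj).le
        gcongr
    omega

lemma card_filter_le (hp2 : p ≠ 2) {f h : (ZMod p)[X]} {x₀ : ZMod p}
    (hf : f = (X - C x₀) * h) (hx : h.eval x₀ ≠ 0) (hf0 : f.coeff 0 ≠ 0) {m : ℕ}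
    (hm : f.natDegree ≤ m) (hmp : (16 * (m + 1)) ^ 2 ≤ p) (ε : ZMod p) :
    ((univ.filter fun x : ZMod p => f.eval x ^ (p / 2) = ε).card : ℝ) ≤
      p / 2 + 20 * (m + 1) * √p := by
  set L := Nat.sqrt p
  have hL1 : L ^ 2 ≤ p := Nat.sqrt_le' p
  have hL2 : p < (L + 1) * (L + 1) := Nat.lt_succ_sqrt p
  have hcL : 16 * (m + 1) ≤ L := Nat.le_sqrt'.mpr hmp
  have hmp' : 8 * (m + 2) ≤ p := by nlinarith
  have hd1 : 2 * ((p - m - 1) / 2) + m < p := by omega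
  have hd2 : p ≤ 4 * ((p - m - 1) / 2 + 1) := by omega
  have hd3 : (p - m - 1) / 2 ≤ p / 2 := by omega
  set d := (p - m - 1) / 2
  have hlp : 2 * L ≤ p := by nlinarith
  have hdim : 2 * L * (d + 2 * L * m + (L + 16 * (m + 1))) <
      2 * (L + 16 * (m + 1)) * (d + 1) := by
    have h1 : L ^ 2 * (2 * m) ≤ p * (2 * m) := by gcongr
    have h2 : L * (16 * (m + 1)) ≤ L * L := by gcongr
    nlinarith
  have key := card_filter_mul_le_of_dim_lt hp2 hf hx hf0 hm hd1 hlp hdim ε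
  set N := (univ.filter fun x : ZMod p => f.eval x ^ (p / 2) = ε).card
  have key' : (N : ℝ) * (2 * L) ≤ 2 * L * m + p / 2 + p / 2 * m + p * (L + 16 * (m + 1)) := by
    have hp : ((p / 2 : ℕ) : ℝ) ≤ p / 2 := Nat.cast_div_le
    have hdr : (d : ℝ) ≤ p / 2 := le_trans (by exact_mod_cast hd3) hp
    have := (Nat.cast_le (α := ℝ)).mpr key
    push_cast at this
    have h3 : ((p / 2 : ℕ) : ℝ) * m ≤ p / 2 * m := by gcongr
    linarith
  have hq : (√p : ℝ) ^ 2 = p := Real.sq_sqrt (by positivity)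
  have hLq : (√p : ℝ) ≤ L + 1 := by
    rw [Real.sqrt_le_left (by positivity)]
    have : (p : ℝ) ≤ (L + 1) * (L + 1) := by exact_mod_cast hL2.le
    nlinarith
  have hLr : (16 * (m + 1) : ℝ) ≤ L := by exact_mod_cast hcL
  have hLp : (L : ℝ) ≤ √p := Real.le_sqrt_of_sq_le (by exact_mod_cast hL1)
  have hm0 : (0 : ℝ) ≤ m := by positivity
  have hL0 : (0 : ℝ) < 2 * L := by linarith
  have hpL : (p : ℝ) ≤ √p * (17 / 16 * L) := by
    have : √(p : ℝ) ≤ 17 / 16 * L := by linarith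
    calc (p : ℝ) = √p * √p := by rw [← pow_two, hq]
      _ ≤ √p * (17 / 16 * L) := by gcongr
  refine le_of_mul_le_mul_right (key'.trans ?_) hL0
  have h5 : (p : ℝ) * (m + 1) ≤ √p * (17 / 16 * L) * (m + 1) := by gcongr
  have h6 : (L : ℝ) * m ≤ L * (√p * (m + 1)) := by
    gcongr
    have : (1 : ℝ) ≤ √p := by linarith
    nlinarith
  have h7 : 0 ≤ √p * L * (m + 1) := by positivity
  nlinarith

/-- Weil's bound for the quadratic character sum of a polynomial with a simple root, up to the
value of the constant. -/
lemma abs_sum_quadraticChar_eval_le (hp2 : p ≠ 2) {f h : (ZMod p)[X]} {x₀ : ZMod p}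
    (hf : f = (X - C x₀) * h) (hx : h.eval x₀ ≠ 0) (hf0 : f.coeff 0 ≠ 0) {m : ℕ}
    (hm : f.natDegree ≤ m) :
    |∑ x : ZMod p, (quadraticChar (ZMod p) (f.eval x) : ℝ)| ≤ 41 * (m + 1) * √p := by
  have hp1 : (1 : ℝ) ≤ √p := by
    rw [Real.one_le_sqrt]
    exact_mod_cast (Fact.out : p.Prime).one_lt.le
  have hm0 : (0 : ℝ) ≤ m := by positivity
  have habs (y : ZMod p) : |(quadraticChar (ZMod p) y : ℝ)| ≤ 1 := by
    by_cases hy : y = 0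
    · simp [hy]
    · rcases quadraticChar_dichotomy hy with h | h <;> simp [h]
  by_cases hmp : (16 * (m + 1)) ^ 2 ≤ p
  · have hring : ringChar (ZMod p) ≠ 2 := by rwa [ZMod.ringChar_zmod_n]
    have hfne : f ≠ 0 := by rintro rfl; simp at hf0
    have : Fact (2 < p) := ⟨lt_of_le_of_ne (Fact.out : p.Prime).two_le hp2.symm⟩
    have hpow (y : ZMod p) : y ^ (p / 2) = (quadraticChar (ZMod p) y : ZMod p) := by
      rw [quadraticChar_eq_pow_of_char_ne_two' hring, ZMod.card]
    have hne : (-1 : ZMod p) ≠ 1 := ZMod.neg_one_ne_one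
    have hval (y : ZMod p) : (quadraticChar (ZMod p) y : ℝ) =
          (if y ^ (p / 2) = 1 then 1 else 0) - (if y ^ (p / 2) = -1 then 1 else 0) ∧
        (1 : ℝ) = (if y ^ (p / 2) = 1 then 1 else 0) + (if y ^ (p / 2) = -1 then 1 else 0) +
          (if y = 0 then 1 else 0) := by
      rw [hpow]
      by_cases hy : y = 0
      · simp [hy]
      · rcases quadraticChar_dichotomy hy with h | h <;> simp [h, hy, hne, hne.symm]
    have hsum := sum_congr (rfl : (univ : Finset (ZMod p)) = univ)
      fun x _ => (hval (f.eval x)).1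
    have hone := sum_congr (rfl : (univ : Finset (ZMod p)) = univ)
      fun x _ => (hval (f.eval x)).2
    rw [sum_sub_distrib, sum_boole, sum_boole] at hsum
    rw [sum_add_distrib, sum_add_distrib, sum_boole, sum_boole, sum_boole, sum_const, card_univ,
      ZMod.card, nsmul_one] at hone
    have hroots : ((univ.filter fun x : ZMod p => f.eval x = 0).card : ℝ) ≤ m := by
      refine Nat.cast_le.mpr (le_trans ?_ hm)
      exact card_le_degree_of_subset_roots fun x hx => by
        simpa [hfne] using hx
    have h1 := card_filter_le hp2 hf hx hf0 hm hmp 1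
    have h2 := card_filter_le hp2 hf hx hf0 hm hmp (-1)
    have h3 : (m : ℝ) ≤ m * √p := le_mul_of_one_le_right hm0 hp1
    rw [hsum, abs_le]
    have h4 := Nat.cast_nonneg (α := ℝ) (univ.filter fun x : ZMod p => f.eval x = 0).card
    constructor <;> nlinarith
  · have hsq : √(p : ℝ) ≤ 16 * (m + 1) := by
      rw [Real.sqrt_le_left (by positivity)]
      exact_mod_cast (not_le.mp hmp).le
    calc _ ≤ ∑ x : ZMod p, |(quadraticChar (ZMod p) (f.eval x) : ℝ)| := abs_sum_le_sum_abs _ _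
      _ ≤ ∑ x : ZMod p, (1 : ℝ) := sum_le_sum fun x _ => habs _
      _ = √p * √p := by simp [ZMod.card]
      _ ≤ 41 * (m + 1) * √p := by gcongr; linarith

lemma abs_sum_prod_quadraticChar_le (hp2 : p ≠ 2) {r : ℕ} {b : Fin r → ZMod p}
    (hb : ∀ j, b j ≠ 0) (hdist : ∀ i j, i ≠ j → b i ^ 2 ≠ b j ^ 2) {S : Finset (Fin r)}
    (hS : S.Nonempty) :
    |∑ t : ZMod p, ∏ j ∈ S, (quadraticChar (ZMod p) (t ^ 2 - 4 * b j ^ 2) : ℝ)| ≤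
      41 * (2 * r + 1) * √p := by
  obtain ⟨i, hi⟩ := hS
  have h2 : (2 : ZMod p) ≠ 0 := by
    refine Ring.two_ne_zero ?_
    rwa [ZMod.ringChar_zmod_n]
  have h4 : (4 : ZMod p) ≠ 0 := by
    rw [show (4 : ZMod p) = 2 * 2 by norm_num]
    exact mul_ne_zero h2 h2
  set f : (ZMod p)[X] := ∏ j ∈ S, (X ^ 2 - C (4 * b j ^ 2)) with hfdef
  have hf : f = (X - C (2 * b i)) *
      ((X + C (2 * b i)) * ∏ j ∈ S.erase i, (X ^ 2 - C (4 * b j ^ 2))) := by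
    rw [hfdef, ← mul_prod_erase S _ hi, ← mul_assoc]
    congr 1
    simp only [C_mul, C_pow]
    rw [show (C 4 : (ZMod p)[X]) = C 2 * C 2 by rw [← C_mul]; norm_num]
    ring
  have hx : ((X + C (2 * b i)) * ∏ j ∈ S.erase i, (X ^ 2 - C (4 * b j ^ 2))).eval (2 * b i) ≠
      0 := by
    rw [eval_mul, eval_prod]
    refine mul_ne_zero ?_ (prod_ne_zero_iff.mpr fun j hj => ?_)
    · simp only [eval_add, eval_X, eval_C]
      rw [show 2 * b i + 2 * b i = 4 * b i by ring]
      exact mul_ne_zero h4 (hb i)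
    · simp only [eval_sub, eval_pow, eval_X, eval_C]
      rw [show (2 * b i) ^ 2 - 4 * b j ^ 2 = 4 * (b i ^ 2 - b j ^ 2) by ring]
      exact mul_ne_zero h4 (sub_ne_zero.mpr (hdist i j (ne_of_mem_erase hj).symm))
  have hf0 : f.coeff 0 ≠ 0 := by
    rw [coeff_zero_eq_eval_zero, eval_prod]
    refine prod_ne_zero_iff.mpr fun j _ => ?_
    simp [h4, hb j]
  have hm : f.natDegree ≤ 2 * r := by
    refine (natDegree_prod_le _ _).trans ((sum_le_card_nsmul _ _ 2 fun j _ => ?_).trans ?_)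
    · rw [natDegree_X_pow_sub_C]
    · have := S.card_le_univ
      rw [Fintype.card_fin] at this
      simp only [smul_eq_mul]
      omega
  have := abs_sum_quadraticChar_eval_le hp2 hf hx hf0 hm
  push_cast at this
  convert this using 4 with t
  rw [hfdef, eval_prod, map_prod]
  simp

lemma abs_two_pow_mul_indicator_sub_prod_le {r : ℕ} (u : Fin r → ZMod p) :
    |(2 ^ r : ℝ) * (if ∀ j, u j ≠ 0 ∧ IsSquare (u j) then 1 else 0) -
      ∏ j, (1 + (quadraticChar (ZMod p) (u j) : ℝ))| ≤
      2 ^ r * ∑ j, if u j = 0 then (1 : ℝ) else 0 := by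
  have hpos : (0 : ℝ) ≤ ∑ j, if u j = 0 then (1 : ℝ) else 0 :=
    sum_nonneg fun j _ => by split_ifs <;> norm_num
  have hfac (j : Fin r) : 0 ≤ 1 + (quadraticChar (ZMod p) (u j) : ℝ) ∧
      1 + (quadraticChar (ZMod p) (u j) : ℝ) ≤ 2 := by
    by_cases hy : u j = 0
    · simp [hy]
    · rcases quadraticChar_dichotomy hy with h | h <;> rw [h] <;> norm_num
  by_cases hz : ∃ j, u j = 0
  · obtain ⟨j, hj⟩ := hz
    rw [if_neg (fun h => (h j).1 hj), mul_zero, zero_sub, abs_neg,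
      abs_of_nonneg (prod_nonneg fun j _ => (hfac j).1)]
    have h1 : (1 : ℝ) ≤ ∑ j, if u j = 0 then (1 : ℝ) else 0 := by
      refine le_trans (by simp [hj]) (single_le_sum (f := fun j => if u j = 0 then (1 : ℝ) else 0)
        (fun j _ => by split_ifs <;> norm_num) (mem_univ j))
    calc _ ≤ ∏ _j : Fin r, (2 : ℝ) := prod_le_prod (fun j _ => (hfac j).1) fun j _ => (hfac j).2
      _ = 2 ^ r := by simp
      _ ≤ _ := le_mul_of_one_le_right (by positivity) h1
  · push Not at hz
    refine le_of_eq_of_le ?_ (mul_nonneg (by positivity) hpos)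
    rw [abs_eq_zero, sub_eq_zero]
    by_cases hg : ∀ j, IsSquare (u j)
    · have h1 (j : Fin r) : quadraticChar (ZMod p) (u j) = 1 :=
        (quadraticChar_one_iff_isSquare (hz j)).mpr (hg j)
      rw [if_pos fun j => ⟨hz j, hg j⟩]
      simp only [h1]
      norm_num
    · rw [if_neg fun h => hg fun j => (h j).2, mul_zero]
      push Not at hg
      obtain ⟨j, hj⟩ := hg
      refine (prod_eq_zero (mem_univ j) ?_).symm
      rw [quadraticChar_neg_one_iff_not_isSquare.mpr hj]
      norm_num

lemma abs_two_pow_mul_ncard_sub_le (hp2 : p ≠ 2) {r : ℕ} {b : Fin r → ZMod p}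
    (hb : ∀ j, b j ≠ 0) (hdist : ∀ i j, i ≠ j → b i ^ 2 ≠ b j ^ 2) :
    |(2 ^ r : ℝ) * (({t : ZMod p | ∀ j : Fin r, t ^ 2 - 4 * b j ^ 2 ≠ 0 ∧
        IsSquare (t ^ 2 - 4 * b j ^ 2)}).ncard : ℝ) - p| ≤
      (2 ^ r * (41 * (2 * r + 1)) + 2 ^ r * (2 * r)) * √p := by
  have hp1 : (1 : ℝ) ≤ √p := by
    rw [Real.one_le_sqrt]
    exact_mod_cast (Fact.out : p.Prime).one_lt.le
  set χ : ZMod p → Fin r → ℝ := fun t j => (quadraticChar (ZMod p) (t ^ 2 - 4 * b j ^ 2) : ℝ)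
  have hN : (({t : ZMod p | ∀ j : Fin r, t ^ 2 - 4 * b j ^ 2 ≠ 0 ∧
      IsSquare (t ^ 2 - 4 * b j ^ 2)}).ncard : ℝ) =
      ∑ t : ZMod p, if ∀ j : Fin r, t ^ 2 - 4 * b j ^ 2 ≠ 0 ∧
        IsSquare (t ^ 2 - 4 * b j ^ 2) then (1 : ℝ) else 0 := by
    classical
    rw [sum_boole, Set.ncard_eq_toFinset_card', Set.toFinset_ofPred]
  have hmain : |∑ t : ZMod p, ∏ j, (1 + χ t j) - p| ≤ 2 ^ r * (41 * (2 * r + 1)) * √p := by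
    have hexp : ∑ t : ZMod p, ∏ j, (1 + χ t j) =
        p + ∑ S ∈ (univ : Finset (Fin r)).powerset.erase ∅, ∑ t : ZMod p, ∏ j ∈ S, χ t j := by
      simp_rw [prod_one_add]
      rw [sum_comm, ← add_sum_erase _ _ (empty_mem_powerset _)]
      simp [ZMod.card]
    rw [hexp, add_sub_cancel_left]
    calc _ ≤ ∑ S ∈ (univ : Finset (Fin r)).powerset.erase ∅, |∑ t : ZMod p, ∏ j ∈ S, χ t j| :=
          abs_sum_le_sum_abs _ _
      _ ≤ ∑ S ∈ (univ : Finset (Fin r)).powerset.erase ∅, 41 * (2 * r + 1) * √p :=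
          sum_le_sum fun S hS => abs_sum_prod_quadraticChar_le hp2 hb hdist
            (nonempty_iff_ne_empty.mpr (ne_of_mem_erase hS))
      _ ≤ ∑ S ∈ (univ : Finset (Fin r)).powerset, 41 * (2 * r + 1) * √p :=
          sum_le_sum_of_subset_of_nonneg (erase_subset _ _) fun _ _ _ => by positivity
      _ = 2 ^ r * (41 * (2 * r + 1)) * √p := by
          rw [sum_const, card_powerset, card_univ, Fintype.card_fin, nsmul_eq_mul]
          push_cast
          ring
  have hroots (j : Fin r) :
      ∑ t : ZMod p, (if t ^ 2 - 4 * b j ^ 2 = 0 then (1 : ℝ) else 0) ≤ 2 := by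
    rw [sum_boole]
    have hsub : (univ.filter fun t : ZMod p => t ^ 2 - 4 * b j ^ 2 = 0) ⊆
        {2 * b j, -(2 * b j)} := fun t ht => by
      have ht : t ^ 2 = (2 * b j) ^ 2 := by
        linear_combination (mem_filter.mp ht).2
      simpa using sq_eq_sq_iff_eq_or_eq_neg.mp ht
    exact_mod_cast (card_le_card hsub).trans card_le_two
  have herr : |(2 ^ r : ℝ) * (∑ t : ZMod p, if ∀ j : Fin r, t ^ 2 - 4 * b j ^ 2 ≠ 0 ∧
      IsSquare (t ^ 2 - 4 * b j ^ 2) then (1 : ℝ) else 0) - ∑ t : ZMod p, ∏ j, (1 + χ t j)| ≤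
      2 ^ r * (2 * r) := by
    rw [mul_sum, ← sum_sub_distrib]
    calc _ ≤ _ := abs_sum_le_sum_abs _ _
      _ ≤ ∑ t : ZMod p, 2 ^ r * ∑ j : Fin r, if t ^ 2 - 4 * b j ^ 2 = 0 then (1 : ℝ) else 0 :=
          sum_le_sum fun t _ => abs_two_pow_mul_indicator_sub_prod_le fun j => t ^ 2 - 4 * b j ^ 2
      _ = 2 ^ r * ∑ j : Fin r, ∑ t : ZMod p,
            if t ^ 2 - 4 * b j ^ 2 = 0 then (1 : ℝ) else 0 := by
          rw [← mul_sum, sum_comm]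
      _ ≤ 2 ^ r * ∑ j : Fin r, (2 : ℝ) := by
          gcongr with j
          exact hroots j
      _ = 2 ^ r * (2 * r) := by
          simp [mul_comm]
  rw [hN]
  refine (abs_sub_le _ _ _).trans ((add_le_add herr hmain).trans ?_)
  have : (2 ^ r * (2 * r) : ℝ) ≤ 2 ^ r * (2 * r) * √p :=
    le_mul_of_one_le_right (by positivity) hp1
  linarith
end

end

/-- **Counting `t` with all `t² - 4a_j²` nonzero squares.** Let `a₁,…,a_r` be nonzero
integers with `a_i² ≠ a_j²` for `i ≠ j`. Then there is a constant `C` such that for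
every odd prime `p` not dividing `a₁⋯a_r·∏_{i<j}(a_i² - a_j²)`, the number `N(p)` of
`t ∈ ℤ/pℤ` such that every `t² - 4a_j²` is a nonzero quadratic residue mod `p`
satisfies `|2^r·N(p) - p| ≤ C·√p`. -/
theorem count_t_allSquares
    (r : ℕ) (a : Fin r → ℤ) (ha : ∀ i, a i ≠ 0)
    (hdist : ∀ i j, i ≠ j → (a i) ^ 2 ≠ (a j) ^ 2) :
    ∃ C : ℝ, 0 < C ∧ ∀ p : ℕ, p.Prime → p ≠ 2 →
      ¬ ((p : ℤ) ∣ (∏ j : Fin r, a j) *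
          ∏ ij ∈ Finset.univ.filter (fun ij : Fin r × Fin r => ij.1 < ij.2),
            ((a ij.1) ^ 2 - (a ij.2) ^ 2)) →
      |(2 ^ r : ℝ) *
          (({t : ZMod p | ∀ j : Fin r,
              t ^ 2 - 4 * ((a j : ℤ) : ZMod p) ^ 2 ≠ 0 ∧
              IsSquare (t ^ 2 - 4 * ((a j : ℤ) : ZMod p) ^ 2)}).ncard : ℝ) -
        (p : ℝ)| ≤ C * Real.sqrt p := by
  refine ⟨2 ^ r * (41 * (2 * r + 1)) + 2 ^ r * (2 * r), by positivity, fun p hp hp2 hdvd => ?_⟩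
  have : Fact p.Prime := ⟨hp⟩
  refine abs_two_pow_mul_ncard_sub_le hp2 (b := fun j => (a j : ZMod p)) (fun j hj => hdvd ?_)
    fun i j hij hsq => hdvd ?_
  · exact ((ZMod.intCast_zmod_eq_zero_iff_dvd _ _).mp hj).trans
      ((dvd_prod_of_mem _ (mem_univ j)).mul_right _)
  · have hlt (i j : Fin r) (hij : i < j) (hsq : (a i : ZMod p) ^ 2 = (a j : ZMod p) ^ 2) :
        (p : ℤ) ∣ (∏ j : Fin r, a j) *
          ∏ ij ∈ Finset.univ.filter (fun ij : Fin r × Fin r => ij.1 < ij.2),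
            ((a ij.1) ^ 2 - (a ij.2) ^ 2) := by
      have h1 : (p : ℤ) ∣ a i ^ 2 - a j ^ 2 := by
        rw [← ZMod.intCast_zmod_eq_zero_iff_dvd]
        push_cast
        exact sub_eq_zero.mpr hsq
      exact (h1.trans (dvd_prod_of_mem (fun ij : Fin r × Fin r => a ij.1 ^ 2 - a ij.2 ^ 2)
        (mem_filter.mpr ⟨mem_univ (i, j), hij⟩))).mul_left _
    rcases lt_or_gt_of_ne hij with h | h
    · exact hlt i j h hsq
    · exact hlt j i h hsq.symm
end
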